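/- Convergence of the BBGKY operators to the Boltzmann-hierarchy operators: Let X := ⊕_{s∈ℕ} L^1_sym(ℝ^{ds}), and let 𝐂^N, 𝐂^∞ : X → X be the hierarchy operators (𝐂^N F)^(s) := Σ_{k=0}^{M−1} C^N_{s,s+k} f^(s+k) and (𝐂^∞ F)^(s) := Σ_{k=0}^{M−1} C^∞_{s,s+k} f^(s+k). Then 𝐂^N converges to 𝐂^∞ in the following sense: for every sequence F_N ∈ X converging pointwise weakly to F ∈ X (i.e. ⟨f_N^(s), φ⟩ → ⟨f^(s), φ⟩ for every s and every φ ∈ L^∞(ℝ^{ds})), one has 𝐂^N F_N →pw 𝐂^∞ F. -/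

import Mathlib

open MeasureTheory Filter Finset
open scoped Classical

noncomputable section

/-- The single-particle velocity space `ℝ^d`. -/
abbrev ESp (d : ℕ) := EuclideanSpace ℝ (Fin d)

/-- Action of a permutation of `{1,…,K}` on `ℝ^{dK}`, permuting the `K` blocks of `ℝ^d`:
`σ(V)_i = V_{σ(i)}`. -/
def permAct {d K : ℕ} (σ : Equiv.Perm (Fin K)) (V : Fin K → ESp d) : Fin K → ESp d :=
  fun i => V (σ i)

/-- `f` is invariant under permutations of its `n` blocks of `d` variables. -/
def SymFun {d n : ℕ} (f : (Fin n → ESp d) → ℝ) : Prop :=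
  ∀ σ : Equiv.Perm (Fin n), ∀ V : Fin n → ESp d, f (fun j => V (σ j)) = f V

/-- Extension `T^ω_{i_1⋯i_K}` of a `K`-particle map to `N` particles: the particles labelled by
`ι` collide according to `Tω`, the others are untouched. -/
def extendMap {d K N : ℕ} (Tω : (Fin K → ESp d) → Fin K → ESp d)
    (ι : Fin K → Fin N) (V : Fin N → ESp d) : Fin N → ESp d :=
  fun j => if h : ∃ a, ι a = j then Tω (fun a => V (ι a)) h.choose else V j

/-- **(H1)**: each `T_K^ω` conserves kinetic energy (is an isometry of `ℝ^{dK}`). -/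
def KacH1 (d M : ℕ) (S : ℕ → Type*)
    (T : ∀ K, S K → (Fin K → ESp d) ≃ₗ[ℝ] (Fin K → ESp d)) : Prop :=
  ∀ K, 1 ≤ K → K ≤ M → ∀ ω : S K, ∀ V : Fin K → ESp d,
    ∑ i : Fin K, ‖T K ω V i‖ ^ 2 = ∑ i : Fin K, ‖V i‖ ^ 2

/-- **(H2)**: on average over the collision kernel, `T_K` is an involution. -/
def KacH2 (d M : ℕ) (S : ℕ → Type*) [∀ K, MeasurableSpace (S K)]
    (b : ∀ K, Measure (S K))
    (T : ∀ K, S K → (Fin K → ESp d) ≃ₗ[ℝ] (Fin K → ESp d)) : Prop :=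
  ∀ K, 1 ≤ K → K ≤ M → ∀ φ : (Fin K → ESp d) → ℝ, Continuous φ →
    ∀ V : Fin K → ESp d,
      ∫ ω, φ ((T K ω).symm V) ∂(b K) = ∫ ω, φ (T K ω V) ∂(b K)

/-- **(H3)**: on average over the collision kernel, `T_K` is invariant under relabelling of the
particles: `∫ φ((σ∘T_K^ω∘σ⁻¹)V) db_K = ∫ φ(T_K^ω V) db_K`. -/
def KacH3 (d M : ℕ) (S : ℕ → Type*) [∀ K, MeasurableSpace (S K)]
    (b : ∀ K, Measure (S K))
    (T : ∀ K, S K → (Fin K → ESp d) ≃ₗ[ℝ] (Fin K → ESp d)) : Prop :=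
  ∀ K, 1 ≤ K → K ≤ M → ∀ σ : Equiv.Perm (Fin K), ∀ φ : (Fin K → ESp d) → ℝ, Continuous φ →
    ∀ V : Fin K → ESp d,
      ∫ ω, φ (permAct σ (T K ω (permAct σ⁻¹ V))) ∂(b K) = ∫ ω, φ (T K ω V) ∂(b K)

/-- Joint measurability of the transformation laws. -/
def KacMeas (d : ℕ) (S : ℕ → Type*) [∀ K, MeasurableSpace (S K)]
    (T : ∀ K, S K → (Fin K → ESp d) ≃ₗ[ℝ] (Fin K → ESp d)) : Prop :=
  ∀ K, Measurable (fun p : S K × (Fin K → ESp d) => T K p.1 p.2)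

/-- The operator `Ω_{i_1⋯i_K} f = ∫_{S_K} (f∘T^ω_{i_1⋯i_K} − f) db_K(ω)`. -/
def OmegaIdx {d : ℕ} {S : ℕ → Type*} [∀ K, MeasurableSpace (S K)]
    (b : ∀ K, Measure (S K))
    (T : ∀ K, S K → (Fin K → ESp d) ≃ₗ[ℝ] (Fin K → ESp d))
    (K N : ℕ) (ι : Fin K → Fin N) (f : (Fin N → ESp d) → ℝ) : (Fin N → ESp d) → ℝ :=
  fun V => ∫ ω, (f (extendMap (⇑(T K ω)) ι V) - f V) ∂(b K)

/-- The index map selecting the slots `i_1,…,i_n, s+1,…,s+r` among `s + r` particles. -/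
def collIdx (s n r K : ℕ) (hK : K = n + r) (i : Fin n → Fin s) : Fin K → Fin (s + r) :=
  fun a =>
    if h : (a : ℕ) < n then Fin.castLE (Nat.le_add_right s r) (i ⟨a, h⟩)
    else ⟨s + ((a : ℕ) - n), by have := a.isLt; omega⟩

/-- The collision operator `C^{s,K,n}_{i_1⋯i_n} : L¹_sym(ℝ^{d(s+r)}) → L¹_sym(ℝ^{ds})`,
`r = K − n`, from Definition 6.1 of the paper. -/
def collOp {d : ℕ} {S : ℕ → Type*} [∀ K, MeasurableSpace (S K)]
    (b : ∀ K, Measure (S K))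
    (T : ∀ K, S K → (Fin K → ESp d) ≃ₗ[ℝ] (Fin K → ESp d))
    (s n r K : ℕ) (hK : K = n + r) (i : Fin n → Fin s)
    (g : (Fin (s + r) → ESp d) → ℝ) : (Fin s → ESp d) → ℝ :=
  fun V => ∫ p : S K × (Fin r → ESp d),
    (g (extendMap (⇑(T K p.1)) (collIdx s n r K hK i) (Fin.append V p.2)) -
      g (Fin.append V p.2)) ∂((b K).prod volume)

/-- The marginal (partial trace) `Tr_{j+1,…,N} f` of an `N`-particle density; it is the zero
function for `j > N`. -/
def margOf {d : ℕ} (N j : ℕ) (f : (Fin N → ESp d) → ℝ) : (Fin j → ESp d) → ℝ :=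
  if h : j ≤ N then
    fun V => ∫ w : Fin (N - j) → ESp d, f (fun a => Fin.append V w (Fin.cast (by omega) a))
  else 0

/-- The BBGKY-hierarchy operator
`C^N_{s,s+k} = Σ_{n=1}^{M−k} β_{k+n} (N/binom(N,k+n)) binom(N−s,k)
  Σ_{i_1<⋯<i_n≤s} C^{s,k+n,n}_{i_1⋯i_n}` (zero when `s + k > N`). -/
def bbgkyC {d : ℕ} {S : ℕ → Type*} [∀ K, MeasurableSpace (S K)]
    (b : ∀ K, Measure (S K))
    (T : ∀ K, S K → (Fin K → ESp d) ≃ₗ[ℝ] (Fin K → ESp d))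
    (M : ℕ) (β : ℕ → ℝ) (N s k : ℕ)
    (g : (Fin (s + k) → ESp d) → ℝ) : (Fin s → ESp d) → ℝ :=
  fun V =>
    if s + k ≤ N then
      ∑ n ∈ Finset.Icc 1 (M - k),
        β (k + n) * ((N : ℝ) / (N.choose (k + n) : ℝ)) * ((N - s).choose k : ℝ) *
          ∑ i : Fin n → Fin s,
            (if StrictMono i then collOp b T s n k (k + n) (by omega) i g V else 0)
    else 0

/-- The Boltzmann-hierarchy operator
`(C^∞_{s,s+k} g)(V_s) = β_{k+1}(k+1) Σ_{i=1}^s ∫ (g(V^{*i}_{s+k}) − g(V_{s+k})) db dv`. -/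
def boltzC {d : ℕ} {S : ℕ → Type*} [∀ K, MeasurableSpace (S K)]
    (b : ∀ K, Measure (S K))
    (T : ∀ K, S K → (Fin K → ESp d) ≃ₗ[ℝ] (Fin K → ESp d))
    (β : ℕ → ℝ) (s k : ℕ)
    (g : (Fin (s + k) → ESp d) → ℝ) : (Fin s → ESp d) → ℝ :=
  fun V => β (k + 1) * ((k : ℝ) + 1) *
    ∑ i : Fin s, collOp b T s 1 k (k + 1) (by omega) (fun _ => i) g V

/-- The generator `Ω` of the Master equation of the generalized Kac model. -/
def masterGen {d : ℕ} {S : ℕ → Type*} [∀ K, MeasurableSpace (S K)]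
    (b : ∀ K, Measure (S K))
    (T : ∀ K, S K → (Fin K → ESp d) ≃ₗ[ℝ] (Fin K → ESp d))
    (M : ℕ) (β : ℕ → ℝ) (N : ℕ)
    (f : (Fin N → ESp d) → ℝ) : (Fin N → ESp d) → ℝ :=
  fun V => (N : ℝ) * ∑ K ∈ Finset.Icc 1 M,
    β K * (1 / ((K.factorial : ℝ) * (N.choose K : ℝ))) *
      ∑ ι : Fin K → Fin N,
        (if Function.Injective ι then OmegaIdx b T K N ι f V else 0)

/-- The solution `e^{tΩ} f₀` of the Master equation, as a pointwise exponential series. -/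
def masterSol {d : ℕ} {S : ℕ → Type*} [∀ K, MeasurableSpace (S K)]
    (b : ∀ K, Measure (S K))
    (T : ∀ K, S K → (Fin K → ESp d) ≃ₗ[ℝ] (Fin K → ESp d))
    (M : ℕ) (β : ℕ → ℝ) (N : ℕ)
    (f₀ : (Fin N → ESp d) → ℝ) (t : ℝ) : (Fin N → ESp d) → ℝ :=
  fun V => ∑' n : ℕ, (t ^ n / (n.factorial : ℝ)) * (masterGen b T M β N)^[n] f₀ V

/-- `f` has `g` as derivative at time `t` in the `L¹(μ)` sense. -/
def HasL1DerivAt {α : Type*} [MeasurableSpace α] (μ : Measure α)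
    (f : ℝ → α → ℝ) (g : α → ℝ) (t : ℝ) : Prop :=
  Tendsto (fun h : ℝ => ∫ x, |(f (t + h) x - f t x) / h - g x| ∂μ)
    (nhdsWithin 0 {(0 : ℝ)}ᶜ) (nhds 0)

/-- A bounded measurable test function (an element of `L^∞`). -/
def BddMeas {α : Type*} [MeasurableSpace α] (φ : α → ℝ) : Prop :=
  Measurable φ ∧ ∃ C : ℝ, ∀ x, |φ x| ≤ C

end

section ExtendMap

variable {d K N : ℕ} {ι : Fin K → Fin N}

theorem extendMap_apply_index (hι : Function.Injective ι)
    (L : (Fin K → ESp d) → Fin K → ESp d) (V : Fin N → ESp d) (a : Fin K) :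
    extendMap L ι V (ι a) = L (fun c => V (ι c)) a := by
  have h : ∃ c, ι c = ι a := ⟨a, rfl⟩
  simp only [extendMap, dif_pos h]
  rw [hι h.choose_spec]

theorem extendMap_apply_of_notMem (L : (Fin K → ESp d) → Fin K → ESp d) (V : Fin N → ESp d)
    {j : Fin N} (hj : j ∉ Set.range ι) : extendMap L ι V j = V j :=
  dif_neg hj

theorem extendMap_leftInverse (hι : Function.Injective ι)
    {L L' : (Fin K → ESp d) → Fin K → ESp d} (h : Function.LeftInverse L' L) :
    Function.LeftInverse (extendMap L' ι) (extendMap L ι) := by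
  intro V
  funext j
  by_cases hj : j ∈ Set.range ι
  · obtain ⟨a, rfl⟩ := hj
    simp only [extendMap_apply_index hι]
    rw [h]
  · simp only [extendMap_apply_of_notMem _ _ hj]

theorem sum_norm_sq_extendMap (hι : Function.Injective ι)
    {L : (Fin K → ESp d) → Fin K → ESp d}
    (hL : ∀ V, ∑ i, ‖L V i‖ ^ 2 = ∑ i, ‖V i‖ ^ 2) (V : Fin N → ESp d) :
    ∑ j, ‖extendMap L ι V j‖ ^ 2 = ∑ j, ‖V j‖ ^ 2 := by
  rw [← sub_eq_zero, ← Finset.sum_sub_distrib]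
  rw [← Fintype.sum_of_injective ι hι
    (fun a => ‖L (fun c => V (ι c)) a‖ ^ 2 - ‖V (ι a)‖ ^ 2)]
  · rw [Finset.sum_sub_distrib, hL, sub_self]
  · intro j hj
    rw [extendMap_apply_of_notMem _ _ hj, sub_self]
  · intro a
    rw [extendMap_apply_index hι]

/-- `extendMap` of a linear map, as a linear map. -/
noncomputable def extendLinearMap (hι : Function.Injective ι)
    (L : (Fin K → ESp d) →ₗ[ℝ] (Fin K → ESp d)) : (Fin N → ESp d) →ₗ[ℝ] (Fin N → ESp d) where
  toFun := extendMap L ι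
  map_add' V W := by
    funext j
    by_cases hj : j ∈ Set.range ι
    · obtain ⟨a, rfl⟩ := hj
      simp only [Pi.add_apply, extendMap_apply_index hι]
      exact congrFun (L.map_add (fun c => V (ι c)) (fun c => W (ι c))) a
    · simp only [Pi.add_apply, extendMap_apply_of_notMem _ _ hj]
  map_smul' r V := by
    funext j
    by_cases hj : j ∈ Set.range ι
    · obtain ⟨a, rfl⟩ := hj
      simp only [Pi.smul_apply, extendMap_apply_index hι]
      exact congrFun (L.map_smul r (fun c => V (ι c))) a
    · simp only [Pi.smul_apply, extendMap_apply_of_notMem _ _ hj, RingHom.id_apply]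

/-- A family of measurable maps extends to a jointly measurable family. -/
theorem measurable_extendMap {Ω : Type*} [MeasurableSpace Ω] (hι : Function.Injective ι)
    {L : Ω → (Fin K → ESp d) → Fin K → ESp d}
    (hL : Measurable fun p : Ω × (Fin K → ESp d) => L p.1 p.2) :
    Measurable fun p : Ω × (Fin N → ESp d) => extendMap (L p.1) ι p.2 := by
  refine measurable_pi_iff.2 fun j => ?_
  by_cases hj : j ∈ Set.range ι
  · obtain ⟨a, rfl⟩ := hj
    simp only [extendMap_apply_index hι]
    have h : Measurable fun p : Ω × (Fin N → ESp d) => (p.1, fun c => p.2 (ι c)) := by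
      fun_prop
    exact (measurable_pi_apply a).comp (hL.comp h)
  · simp only [extendMap_apply_of_notMem _ _ hj]
    fun_prop

end ExtendMap

/-- A linear map of `ℝ^{dn}` preserving the Euclidean energy preserves Lebesgue measure. -/
theorem measurePreserving_of_sum_norm_sq {d n : ℕ}
    (A : (Fin n → ESp d) →ₗ[ℝ] (Fin n → ESp d))
    (hA : ∀ V, ∑ i, ‖A V i‖ ^ 2 = ∑ i, ‖V i‖ ^ 2) :
    MeasurePreserving A volume volume := by
  have hcont : Continuous A := A.continuous_of_finiteDimensional
  have hinj : Function.Injective A := by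
    rw [injective_iff_map_eq_zero]
    intro V hV
    have h0 : ∑ i, ‖V i‖ ^ 2 = 0 := by rw [← hA, hV]; simp
    funext i
    have := (Finset.sum_eq_zero_iff_of_nonneg fun i _ => sq_nonneg ‖V i‖).1 h0 i (mem_univ i)
    simpa using this
  have hdet : LinearMap.det A ≠ 0 := by
    have hunit := LinearEquiv.isUnit_det' (LinearEquiv.ofInjectiveEndo A hinj)
    have he : (LinearEquiv.ofInjectiveEndo A hinj : (Fin n → ESp d) →ₗ[ℝ] _) = A := by
      ext; simp
    rw [he] at hunit
    exact hunit.ne_zero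
  let U : Set (Fin n → ESp d) := {V | ∑ i, ‖V i‖ ^ 2 < 1}
  have hUpre : A ⁻¹' U = U := by
    ext V
    simp [U, hA]
  have hUopen : IsOpen U := isOpen_lt (by fun_prop) continuous_const
  have hUpos : volume U ≠ 0 := (hUopen.measure_pos volume ⟨0, by simp [U]⟩).ne'
  have hUfin : volume U ≠ ⊤ := by
    refine ((measure_mono (t := Metric.closedBall 0 1) ?_).trans_lt
      measure_closedBall_lt_top).ne
    intro V hV
    rw [mem_closedBall_zero_iff, pi_norm_le_iff_of_nonneg zero_le_one]
    intro i
    have h : ‖V i‖ ^ 2 ≤ ∑ i, ‖V i‖ ^ 2 :=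
      Finset.single_le_sum (f := fun i => ‖V i‖ ^ 2) (fun i _ => sq_nonneg _) (mem_univ i)
    have h' : ∑ i, ‖V i‖ ^ 2 < 1 := hV
    nlinarith [norm_nonneg (V i)]
  have hone : ENNReal.ofReal |(LinearMap.det A)⁻¹| = 1 := by
    have h := Measure.addHaar_preimage_linearMap (volume : Measure (Fin n → ESp d)) hdet U
    rw [hUpre] at h
    exact ((ENNReal.mul_eq_right hUpos hUfin).1 h.symm)
  refine ⟨hcont.measurable, ?_⟩
  rw [Measure.map_linearMap_addHaar_eq_smul_addHaar _ hdet, hone, one_smul]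

/-- The inverse of a linear energy-preserving map is its adjoint. -/
theorem symm_apply_eq_sum_inner {d n : ℕ} (A : (Fin n → ESp d) ≃ₗ[ℝ] (Fin n → ESp d))
    (hA : ∀ V, ∑ i, ‖A V i‖ ^ 2 = ∑ i, ‖V i‖ ^ 2) (W : Fin n → ESp d) (j : Fin n) (c : Fin d) :
    A.symm W j c =
      ∑ i, inner ℝ (W i) (A (Pi.single j (EuclideanSpace.single c (1 : ℝ))) i) := by
  have polar : ∀ V U : Fin n → ESp d,
      ∑ i, inner ℝ (A V i) (A U i) = ∑ i, inner ℝ (V i) (U i) := by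
    intro V U
    have h := hA (V + U)
    simp only [map_add, Pi.add_apply, norm_add_sq_real, Finset.sum_add_distrib, hA,
      ← Finset.mul_sum] at h
    linarith
  have h := polar (A.symm W) (Pi.single j (EuclideanSpace.single c (1 : ℝ)))
  rw [A.apply_symm_apply] at h
  rw [h, Finset.sum_eq_single j]
  · simp [EuclideanSpace.inner_single_right]
  · intro i _ hi
    simp [Pi.single_eq_of_ne hi]
  · simp

theorem measurable_symm_of_sum_norm_sq {d n : ℕ} {Ω : Type*} [MeasurableSpace Ω]
    {A : Ω → (Fin n → ESp d) ≃ₗ[ℝ] (Fin n → ESp d)}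
    (hA : ∀ ω V, ∑ i, ‖A ω V i‖ ^ 2 = ∑ i, ‖V i‖ ^ 2)
    (hm : Measurable fun p : Ω × (Fin n → ESp d) => A p.1 p.2) :
    Measurable fun p : Ω × (Fin n → ESp d) => (A p.1).symm p.2 := by
  refine measurable_pi_iff.2 fun j => ?_
  suffices hcoord : Measurable fun p : Ω × (Fin n → ESp d) => fun c => (A p.1).symm p.2 j c from
    (WithLp.measurable_toLp 2 (Fin d → ℝ)).comp hcoord
  refine measurable_pi_iff.2 fun c => ?_
  have h : (fun p : Ω × (Fin n → ESp d) => (A p.1).symm p.2 j c) = fun p =>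
      ∑ i, inner ℝ (p.2 i) (A p.1 (Pi.single j (EuclideanSpace.single c (1 : ℝ))) i) :=
    funext fun p => symm_apply_eq_sum_inner (A p.1) (hA p.1) p.2 j c
  rw [h]
  refine Finset.measurable_sum _ fun i _ => Measurable.inner (by fun_prop) ?_
  have hpair : Measurable fun p : Ω × (Fin n → ESp d) =>
      (p.1, (Pi.single j (EuclideanSpace.single c (1 : ℝ)) : Fin n → ESp d)) := by fun_prop
  exact (measurable_pi_apply i).comp (hm.comp hpair)

theorem collIdx_injective {s n r K : ℕ} (hK : K = n + r) {i : Fin n → Fin s}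
    (hi : Function.Injective i) : Function.Injective (collIdx s n r K hK i) := by
  intro a a' h
  have h' := congrArg Fin.val h
  unfold collIdx at h'
  split_ifs at h' with ha ha' ha'
  · have := hi (Fin.ext (by simpa using h'))
    exact Fin.ext (by simpa using this)
  · have := (i ⟨a, ha⟩).isLt
    simp at h'
    omega
  · have := (i ⟨a', ha'⟩).isLt
    simp at h'
    omega
  · exact Fin.ext (by simp at h'; omega)

/-- Concatenation of velocity vectors preserves Lebesgue measure. -/
theorem measurePreserving_finAppend (d s r : ℕ) :
    MeasurePreserving (fun p : (Fin s → ESp d) × (Fin r → ESp d) => Fin.append p.1 p.2)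
      (volume.prod volume) volume := by
  have h := (volume_measurePreserving_piCongrLeft (fun _ : Fin (s + r) => ESp d)
    finSumFinEquiv).comp
      (volume_measurePreserving_sumPiEquivProdPi_symm (fun _ : Fin s ⊕ Fin r => ESp d))
  convert! h using 1
  funext p
  funext j
  refine Fin.addCases (fun a => ?_) (fun a => ?_) j
  · simp only [Fin.append_left]
    exact (MeasurableEquiv.piCongrLeft_apply_apply (β := fun _ : Fin (s + r) => ESp d)
      finSumFinEquiv ((MeasurableEquiv.sumPiEquivProdPi fun _ : Fin s ⊕ Fin r => ESp d).symm p)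
      (Sum.inl a)).symm
  · simp only [Fin.append_right]
    exact (MeasurableEquiv.piCongrLeft_apply_apply (β := fun _ : Fin (s + r) => ESp d)
      finSumFinEquiv ((MeasurableEquiv.sumPiEquivProdPi fun _ : Fin s ⊕ Fin r => ESp d).symm p)
      (Sum.inr a)).symm

theorem MeasureTheory.MeasurePreserving.integral_comp_of_integrable {α γ : Type*}
    [MeasurableSpace α] [MeasurableSpace γ] {μ : Measure α} {ν : Measure γ} {f : α → γ}
    (hf : MeasurePreserving f μ ν) {g : γ → ℝ} (hg : Integrable g ν) :
    ∫ x, g (f x) ∂μ = ∫ y, g y ∂ν := by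
  rw [← hf.map_eq] at hg ⊢
  exact (integral_map hf.measurable.aemeasurable hg.aestronglyMeasurable).symm

/-- Rearranging `(V, (ω, w))` into `(ω, V ⌢ w)` preserves the product measure. -/
theorem measurePreserving_prodMk_finAppend {Ω : Type*} [MeasurableSpace Ω] (μ : Measure Ω)
    [SFinite μ] (d s r : ℕ) :
    MeasurePreserving
      (fun p : (Fin s → ESp d) × (Ω × (Fin r → ESp d)) => (p.2.1, Fin.append p.1 p.2.2))
      (volume.prod (μ.prod volume)) (μ.prod volume) :=
  ((MeasurePreserving.id μ).prod (measurePreserving_finAppend d s r)).comp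
    ((measurePreserving_prodAssoc μ volume volume).comp
      (((Measure.measurePreserving_swap (μ := volume) (ν := μ)).prod
        (MeasurePreserving.id volume)).comp
          (measurePreserving_prodAssoc volume μ volume).symm))

theorem BddMeas.integrable_mul {α : Type*} [MeasurableSpace α] {μ : Measure α} {f φ : α → ℝ}
    (hφ : BddMeas φ) (hf : Integrable f μ) : Integrable (fun x => f x * φ x) μ := by
  obtain ⟨C, hC⟩ := hφ.2
  exact hf.mul_bdd hφ.1.aestronglyMeasurable (Eventually.of_forall hC)

theorem BddMeas.comp {α γ : Type*} [MeasurableSpace α] [MeasurableSpace γ] {φ : γ → ℝ}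
    (hφ : BddMeas φ) {f : α → γ} (hf : Measurable f) : BddMeas fun x => φ (f x) :=
  ⟨hφ.1.comp hf, hφ.2.imp fun _ hC x => hC (f x)⟩

theorem BddMeas.sub {α : Type*} [MeasurableSpace α] {φ ψ : α → ℝ}
    (hφ : BddMeas φ) (hψ : BddMeas ψ) : BddMeas fun x => φ x - ψ x := by
  obtain ⟨C, hC⟩ := hφ.2
  obtain ⟨D, hD⟩ := hψ.2
  exact ⟨hφ.1.sub hψ.1, C + D, fun x => (abs_sub _ _).trans (add_le_add (hC x) (hD x))⟩

theorem BddMeas.integral_prod_left {Ω α : Type*} [MeasurableSpace Ω] [MeasurableSpace α]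
    {μ : Measure Ω} [IsProbabilityMeasure μ] {φ : Ω × α → ℝ} (hφ : BddMeas φ) :
    BddMeas fun x => ∫ ω, φ (ω, x) ∂μ := by
  obtain ⟨C, hC⟩ := hφ.2
  refine ⟨(hφ.1.stronglyMeasurable.integral_prod_left').measurable, C, fun x => ?_⟩
  simpa using norm_integral_le_of_norm_le_const (μ := μ) (f := fun ω => φ (ω, x)) (C := C)
    (Eventually.of_forall fun ω => hC (ω, x))

/-- The adjoint of `collOp`, acting on test functions. -/
noncomputable def collAdj {d : ℕ} {S : ℕ → Type*} [∀ K, MeasurableSpace (S K)]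
    (b : ∀ K, Measure (S K))
    (T : ∀ K, S K → (Fin K → ESp d) ≃ₗ[ℝ] (Fin K → ESp d))
    (s n r K : ℕ) (hK : K = n + r) (i : Fin n → Fin s)
    (φ : (Fin s → ESp d) → ℝ) : (Fin (s + r) → ESp d) → ℝ :=
  fun W => ∫ ω,
    (φ (fun a => extendMap (⇑(T K ω).symm) (collIdx s n r K hK i) W (Fin.castAdd r a)) -
      φ (fun a => W (Fin.castAdd r a))) ∂(b K)

section Adjoint

variable {d : ℕ} {S : ℕ → Type*} [∀ K, MeasurableSpace (S K)]
  {b : ∀ K, Measure (S K)} [∀ K, IsProbabilityMeasure (b K)]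
  {T : ∀ K, S K → (Fin K → ESp d) ≃ₗ[ℝ] (Fin K → ESp d)}
  {s n r K : ℕ} {hK : K = n + r} {i : Fin n → Fin s}

theorem bddMeas_collAdj_integrand (hmeas : KacMeas d S T)
    (hE : ∀ ω V, ∑ j, ‖T K ω V j‖ ^ 2 = ∑ j, ‖V j‖ ^ 2) (hi : Function.Injective i)
    {φ : (Fin s → ESp d) → ℝ} (hφ : BddMeas φ) :
    BddMeas fun p : S K × (Fin (s + r) → ESp d) =>
      φ (fun a => extendMap (⇑(T K p.1).symm) (collIdx s n r K hK i) p.2 (Fin.castAdd r a)) := by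
  have hm := measurable_extendMap (collIdx_injective hK hi)
    (L := fun ω => ⇑(T K ω).symm) (measurable_symm_of_sum_norm_sq hE (hmeas K))
  exact hφ.comp (measurable_pi_iff.2 fun a => (measurable_pi_apply (Fin.castAdd r a)).comp hm)

theorem bddMeas_collAdj (hmeas : KacMeas d S T)
    (hE : ∀ ω V, ∑ j, ‖T K ω V j‖ ^ 2 = ∑ j, ‖V j‖ ^ 2) (hi : Function.Injective i)
    {φ : (Fin s → ESp d) → ℝ} (hφ : BddMeas φ) :
    BddMeas (collAdj b T s n r K hK i φ) :=
  ((bddMeas_collAdj_integrand hmeas hE hi hφ).sub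
    (hφ.comp (f := fun p : S K × (Fin (s + r) → ESp d) => fun a => p.2 (Fin.castAdd r a))
      (by fun_prop))).integral_prod_left

/-- The collision map acting fibrewise over the collision parameters preserves the measure. -/
theorem measurePreserving_collision (hmeas : KacMeas d S T)
    (hE : ∀ ω V, ∑ j, ‖T K ω V j‖ ^ 2 = ∑ j, ‖V j‖ ^ 2) (hi : Function.Injective i) :
    MeasurePreserving (fun p : S K × (Fin (s + r) → ESp d) =>
        (p.1, extendMap (⇑(T K p.1)) (collIdx s n r K hK i) p.2))
      ((b K).prod volume) ((b K).prod volume) := by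
  have hι := collIdx_injective hK hi
  refine (MeasurePreserving.id (b K)).skew_product
    (g := fun ω => extendMap (⇑(T K ω)) (collIdx s n r K hK i))
    (measurable_extendMap hι (L := fun ω => ⇑(T K ω)) (hmeas K)) (Eventually.of_forall fun ω => ?_)
  exact (measurePreserving_of_sum_norm_sq (extendLinearMap hι (T K ω).toLinearMap)
    (sum_norm_sq_extendMap hι (hE ω))).map_eq

theorem integrable_collision_sub (hmeas : KacMeas d S T)
    (hE : ∀ ω V, ∑ j, ‖T K ω V j‖ ^ 2 = ∑ j, ‖V j‖ ^ 2) (hi : Function.Injective i)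
    {g : (Fin (s + r) → ESp d) → ℝ} (hg : Integrable g) :
    Integrable (fun p : S K × (Fin (s + r) → ESp d) =>
      g (extendMap (⇑(T K p.1)) (collIdx s n r K hK i) p.2) - g p.2) ((b K).prod volume) :=
  ((measurePreserving_collision hmeas hE hi).integrable_comp_of_integrable
    (hg.comp_snd (b K))).sub (hg.comp_snd (b K))

theorem integrable_collOp (hmeas : KacMeas d S T)
    (hE : ∀ ω V, ∑ j, ‖T K ω V j‖ ^ 2 = ∑ j, ‖V j‖ ^ 2) (hi : Function.Injective i)
    {g : (Fin (s + r) → ESp d) → ℝ} (hg : Integrable g) :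
    Integrable (collOp b T s n r K hK i g) :=
  ((measurePreserving_prodMk_finAppend (b K) d s r).integrable_comp_of_integrable
    (integrable_collision_sub hmeas hE hi hg)).integral_prod_left

/-- Duality between the collision operator and its adjoint on test functions. -/
theorem integral_collOp_mul (hmeas : KacMeas d S T)
    (hE : ∀ ω V, ∑ j, ‖T K ω V j‖ ^ 2 = ∑ j, ‖V j‖ ^ 2) (hi : Function.Injective i)
    {g : (Fin (s + r) → ESp d) → ℝ} (hg : Integrable g)
    {φ : (Fin s → ESp d) → ℝ} (hφ : BddMeas φ) :
    ∫ V, collOp b T s n r K hK i g V * φ V = ∫ W, g W * collAdj b T s n r K hK i φ W := by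
  have hι := collIdx_injective hK hi
  have happ := measurePreserving_prodMk_finAppend (b K) d s r
  have hcoll := measurePreserving_collision (b := b) (r := r) (hK := hK) hmeas hE hi
  have hg2 : Integrable (fun p : S K × (Fin (s + r) → ESp d) => g p.2) ((b K).prod volume) :=
    hg.comp_snd (b K)
  have hφ2 : BddMeas fun p : S K × (Fin (s + r) → ESp d) =>
      φ (fun a => p.2 (Fin.castAdd r a)) := hφ.comp (by fun_prop)
  have hψ := bddMeas_collAdj_integrand (r := r) (hK := hK) hmeas hE hi hφ
  have hint := hφ2.integrable_mul (integrable_collision_sub (b := b) (hK := hK) hmeas hE hi hg)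
  have hgain := hψ.integrable_mul hg2
  have hloss := hφ2.integrable_mul hg2
  set ι := collIdx s n r K hK i
  have hinv : ∀ ω W, extendMap (⇑(T K ω).symm) ι (extendMap (⇑(T K ω)) ι W) = W :=
    fun ω => extendMap_leftInverse hι (T K ω).symm_apply_apply
  have hgain_comp : ∀ p : S K × (Fin (s + r) → ESp d),
      g (extendMap (⇑(T K p.1)) ι p.2) * φ (fun a => p.2 (Fin.castAdd r a)) =
        g (extendMap (⇑(T K p.1)) ι p.2) * φ (fun a =>
          extendMap (⇑(T K p.1).symm) ι (extendMap (⇑(T K p.1)) ι p.2) (Fin.castAdd r a)) := by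
    intro p
    rw [hinv]
  calc ∫ V, collOp b T s n r K hK i g V * φ V
      = ∫ V, ∫ p : S K × (Fin r → ESp d),
          (g (extendMap (⇑(T K p.1)) ι (Fin.append V p.2)) - g (Fin.append V p.2)) *
            φ (fun a => Fin.append V p.2 (Fin.castAdd r a)) ∂((b K).prod volume) := by
        simp only [Fin.append_left, integral_mul_const]
        rfl
    _ = ∫ p, (g (extendMap (⇑(T K p.1)) ι p.2) - g p.2) *
          φ (fun a => p.2 (Fin.castAdd r a)) ∂((b K).prod volume) := by
        rw [← happ.integral_comp_of_integrable hint]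
        exact (integral_prod _ (happ.integrable_comp_of_integrable hint)).symm
    _ = ∫ p, g (extendMap (⇑(T K p.1)) ι p.2) *
            φ (fun a => p.2 (Fin.castAdd r a)) ∂((b K).prod volume) -
          ∫ p, g p.2 * φ (fun a => p.2 (Fin.castAdd r a)) ∂((b K).prod volume) := by
        simp only [sub_mul]
        refine integral_sub ?_ hloss
        simp only [hgain_comp]
        exact hcoll.integrable_comp_of_integrable hgain
    _ = ∫ p, g p.2 * φ (fun a => extendMap (⇑(T K p.1).symm) ι p.2 (Fin.castAdd r a))
            ∂((b K).prod volume) -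
          ∫ p, g p.2 * φ (fun a => p.2 (Fin.castAdd r a)) ∂((b K).prod volume) := by
        simp only [hgain_comp]
        rw [← hcoll.integral_comp_of_integrable hgain]
    _ = ∫ p, g p.2 * (φ (fun a => extendMap (⇑(T K p.1).symm) ι p.2 (Fin.castAdd r a)) -
          φ (fun a => p.2 (Fin.castAdd r a))) ∂((b K).prod volume) := by
        rw [← integral_sub hgain hloss]
        simp only [mul_sub]
    _ = ∫ W, g W * collAdj b T s n r K hK i φ W := by
        rw [integral_prod_symm _ ((hψ.sub hφ2).integrable_mul hg2)]
        simp only [integral_const_mul]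
        rfl

end Adjoint

open Asymptotics in
/-- The combinatorial coefficients of the BBGKY operators converge, and only the terms with a
single pre-existing particle survive. -/
theorem tendsto_bbgky_coeff (s k n : ℕ) (hn : 1 ≤ n) :
    Tendsto (fun N : ℕ => (N : ℝ) / (N.choose (k + n) : ℝ) * ((N - s).choose k : ℝ)) atTop
      (nhds (if n = 1 then (k : ℝ) + 1 else 0)) := by
  have hsub : (fun N : ℕ => ((N - s : ℕ) : ℝ)) ~[atTop] fun N : ℕ => (N : ℝ) := by
    have h : (fun N : ℕ => (N : ℝ) - (s : ℝ)) ~[atTop] fun N : ℕ => (N : ℝ) :=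
      IsEquivalent.refl.sub_isLittleO
        (isLittleO_const_left.2 (Or.inr (tendsto_norm_atTop_atTop.comp
          tendsto_natCast_atTop_atTop)))
    refine h.congr_left ?_
    filter_upwards [eventually_ge_atTop s] with N hN
    exact (Nat.cast_sub hN).symm
  have hchoose : (fun N : ℕ => ((N - s).choose k : ℝ)) ~[atTop]
      fun N : ℕ => (N : ℝ) ^ k / (k.factorial : ℝ) :=
    ((isEquivalent_choose k).comp_tendsto (tendsto_sub_atTop_nat s)).trans
      ((hsub.pow k).div IsEquivalent.refl)
  have hequiv : (fun N : ℕ => (N : ℝ) / (N.choose (k + n) : ℝ) * ((N - s).choose k : ℝ)) ~[atTop]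
      fun N : ℕ => (N : ℝ) / ((N : ℝ) ^ (k + n) / ((k + n).factorial : ℝ)) *
        ((N : ℝ) ^ k / (k.factorial : ℝ)) :=
    (IsEquivalent.refl.div (isEquivalent_choose (k + n))).mul hchoose
  refine hequiv.symm.tendsto_nhds ?_
  have hlim : Tendsto (fun N : ℕ => ((k + n).factorial : ℝ) / (k.factorial : ℝ) *
      ((N : ℝ)⁻¹) ^ (n - 1)) atTop (nhds (if n = 1 then (k : ℝ) + 1 else 0)) := by
    have hk : (k.factorial : ℝ) ≠ 0 := by positivity
    split_ifs with h
    · subst h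
      simp only [Nat.factorial_succ, le_refl, tsub_eq_zero_of_le, pow_zero, mul_one]
      push_cast
      rw [mul_div_cancel_right₀ _ hk]
      exact tendsto_const_nhds
    · have h0 := ((tendsto_inv_atTop_nhds_zero_nat (𝕜 := ℝ)).pow (n - 1)).const_mul
        (((k + n).factorial : ℝ) / (k.factorial : ℝ))
      rwa [zero_pow (by omega), mul_zero] at h0
  refine hlim.congr' ?_
  filter_upwards [eventually_ge_atTop 1] with N hN
  have hN0 : (N : ℝ) ≠ 0 := by positivity
  obtain ⟨m, rfl⟩ : ∃ m, n = m + 1 := ⟨n - 1, by omega⟩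
  simp only [Nat.add_sub_cancel, inv_pow]
  field_simp
  ring

section Hierarchy

variable {d : ℕ} {S : ℕ → Type*} [∀ K, MeasurableSpace (S K)]
  {b : ∀ K, Measure (S K)} [∀ K, IsProbabilityMeasure (b K)]
  {T : ∀ K, S K → (Fin K → ESp d) ≃ₗ[ℝ] (Fin K → ESp d)} {M : ℕ} {β : ℕ → ℝ}

theorem integrable_bbgkyC (hmeas : KacMeas d S T) (h1 : KacH1 d M S T) {s k : ℕ} (hk : k < M)
    (N : ℕ) {g : (Fin (s + k) → ESp d) → ℝ} (hg : Integrable g) :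
    Integrable (bbgkyC b T M β N s k g) := by
  unfold bbgkyC
  split_ifs
  · refine integrable_finsetSum _ fun n hn => Integrable.const_mul
      (integrable_finsetSum _ fun i _ => ?_) _
    rw [Finset.mem_Icc] at hn
    split_ifs with hi
    · exact integrable_collOp hmeas (h1 (k + n) (by omega) (by omega)) hi.injective hg
    · exact integrable_zero _ _ _
  · exact integrable_zero _ _ _

theorem integral_bbgkyC_mul (hmeas : KacMeas d S T) (h1 : KacH1 d M S T) {s k : ℕ} (hk : k < M)
    {N : ℕ} (hN : s + k ≤ N) {g : (Fin (s + k) → ESp d) → ℝ} (hg : Integrable g)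
    {φ : (Fin s → ESp d) → ℝ} (hφ : BddMeas φ) :
    ∫ V, bbgkyC b T M β N s k g V * φ V =
      ∑ n ∈ Finset.Icc 1 (M - k),
        β (k + n) * ((N : ℝ) / (N.choose (k + n) : ℝ)) * ((N - s).choose k : ℝ) *
          ∑ i : Fin n → Fin s, (if StrictMono i then
            ∫ W, g W * collAdj b T s n k (k + n) (by omega) i φ W else 0) := by
  have hE : ∀ n ∈ Finset.Icc 1 (M - k), ∀ ω V,
      ∑ j, ‖T (k + n) ω V j‖ ^ 2 = ∑ j, ‖V j‖ ^ 2 := fun n hn => by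
    rw [Finset.mem_Icc] at hn
    exact h1 (k + n) (by omega) (by omega)
  have hint : ∀ n ∈ Finset.Icc 1 (M - k), ∀ i : Fin n → Fin s,
      Integrable fun V =>
        (if StrictMono i then collOp b T s n k (k + n) (by omega) i g V else 0) * φ V := by
    intro n hn i
    split_ifs with hi
    · exact hφ.integrable_mul (integrable_collOp hmeas (hE n hn) hi.injective hg)
    · simp
  simp only [bbgkyC, if_pos hN, Finset.sum_mul, mul_assoc]
  rw [integral_finsetSum _ fun n hn => ?_]
  · refine Finset.sum_congr rfl fun n hn => ?_
    simp only [integral_const_mul]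
    rw [integral_finsetSum _ fun i _ => hint n hn i]
    congr! 4 with i
    split_ifs with hi
    · exact integral_collOp_mul hmeas (hE n hn) hi.injective hg hφ
    · simp
  · exact (((integrable_finsetSum _ fun i _ => hint n hn i).const_mul _).const_mul _).const_mul _

theorem integrable_boltzC (hmeas : KacMeas d S T) (h1 : KacH1 d M S T) {s k : ℕ} (hk : k < M)
    {g : (Fin (s + k) → ESp d) → ℝ} (hg : Integrable g) : Integrable (boltzC b T β s k g) :=
  (integrable_finsetSum _ fun _ _ =>
    integrable_collOp hmeas (h1 (k + 1) (by omega) (by omega))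
      (Function.injective_of_subsingleton _) hg).const_mul _

theorem integral_boltzC_mul (hmeas : KacMeas d S T) (h1 : KacH1 d M S T) {s k : ℕ} (hk : k < M)
    {g : (Fin (s + k) → ESp d) → ℝ} (hg : Integrable g)
    {φ : (Fin s → ESp d) → ℝ} (hφ : BddMeas φ) :
    ∫ V, boltzC b T β s k g V * φ V =
      β (k + 1) * ((k : ℝ) + 1) *
        ∑ i : Fin s, ∫ W, g W * collAdj b T s 1 k (k + 1) (by omega) (fun _ => i) φ W := by
  have hE := h1 (k + 1) (by omega) (by omega)
  simp only [boltzC, mul_assoc, Finset.sum_mul, integral_const_mul]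
  rw [integral_finsetSum _ fun i _ => hφ.integrable_mul
    (integrable_collOp hmeas hE (Function.injective_of_subsingleton _) hg)]
  congr! 4 with i
  exact integral_collOp_mul hmeas hE (Function.injective_of_subsingleton _) hg hφ

theorem tendsto_integral_bbgkyC_mul (hmeas : KacMeas d S T) (h1 : KacH1 d M S T) {s k : ℕ}
    (hk : k < M) {gN : ℕ → (Fin (s + k) → ESp d) → ℝ} {g : (Fin (s + k) → ESp d) → ℝ}
    (hgN : ∀ N, Integrable (gN N)) (hg : Integrable g)
    (hpw : ∀ ψ : (Fin (s + k) → ESp d) → ℝ, BddMeas ψ →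
      Tendsto (fun N => ∫ W, gN N W * ψ W) atTop (nhds (∫ W, g W * ψ W)))
    {φ : (Fin s → ESp d) → ℝ} (hφ : BddMeas φ) :
    Tendsto (fun N => ∫ V, bbgkyC b T M β N s k (gN N) V * φ V) atTop
      (nhds (∫ V, boltzC b T β s k g V * φ V)) := by
  have hlim : Tendsto (fun N : ℕ => ∑ n ∈ Finset.Icc 1 (M - k),
        β (k + n) * ((N : ℝ) / (N.choose (k + n) : ℝ)) * ((N - s).choose k : ℝ) *
          ∑ i : Fin n → Fin s, (if StrictMono i then
            ∫ W, gN N W * collAdj b T s n k (k + n) (by omega) i φ W else 0)) atTop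
      (nhds (∑ n ∈ Finset.Icc 1 (M - k), β (k + n) * (if n = 1 then (k : ℝ) + 1 else 0) *
          ∑ i : Fin n → Fin s, (if StrictMono i then
            ∫ W, g W * collAdj b T s n k (k + n) (by omega) i φ W else 0))) := by
    refine tendsto_finsetSum _ fun n hn => ?_
    rw [Finset.mem_Icc] at hn
    refine Tendsto.mul ?_ (tendsto_finsetSum _ fun i _ => ?_)
    · simpa only [mul_assoc] using (tendsto_bbgky_coeff s k n hn.1).const_mul (β (k + n))
    · split_ifs with hi
      · exact hpw _ (bddMeas_collAdj hmeas (h1 (k + n) (by omega) (by omega)) hi.injective hφ)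
      · exact tendsto_const_nhds
  have hvalue : ∑ n ∈ Finset.Icc 1 (M - k), β (k + n) * (if n = 1 then (k : ℝ) + 1 else 0) *
        ∑ i : Fin n → Fin s, (if StrictMono i then
          ∫ W, g W * collAdj b T s n k (k + n) (by omega) i φ W else 0) =
      ∫ V, boltzC b T β s k g V * φ V := by
    rw [integral_boltzC_mul hmeas h1 hk hg hφ, Finset.sum_eq_single_of_mem 1
      (Finset.mem_Icc.2 ⟨le_rfl, by omega⟩) fun n _ hn => by simp [hn], if_pos rfl]
    congr 1
    refine (Fintype.sum_equiv (Equiv.funUnique (Fin 1) (Fin s)).symm _ _ fun i => ?_).symm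
    rw [if_pos (Subsingleton.strictMono _)]
    rfl
  rw [← hvalue]
  refine hlim.congr' ?_
  filter_upwards [eventually_ge_atTop (s + k)] with N hN
  exact (integral_bbgkyC_mul hmeas h1 hk hN (hgN N) hφ).symm

end Hierarchy

/-- **Convergence of the BBGKY operators to the Boltzmann-hierarchy operators** (Lemma 6.5 of
the paper). For every sequence `F_N ∈ X = ⊕_s L¹_sym(ℝ^{ds})` converging pointwise weakly to
`F ∈ X` (tested against all `φ ∈ L^∞(ℝ^{ds})`), the hierarchy operators satisfy
`𝐂^N F_N →pw 𝐂^∞ F`. -/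
theorem stmt10 (d M : ℕ) (S : ℕ → Type*) [∀ K, MeasurableSpace (S K)]
    (b : ∀ K, Measure (S K)) [∀ K, IsProbabilityMeasure (b K)]
    (T : ∀ K, S K → (Fin K → ESp d) ≃ₗ[ℝ] (Fin K → ESp d))
    (hmeas : KacMeas d S T)
    (h1 : KacH1 d M S T) (h2 : KacH2 d M S b T) (h3 : KacH3 d M S b T)
    (β : ℕ → ℝ) (hβ : ∀ K, 0 ≤ β K) (hβ1 : ∑ K ∈ Finset.Icc 1 M, β K = 1)
    (FN : ℕ → ∀ s : ℕ, (Fin s → ESp d) → ℝ) (F : ∀ s : ℕ, (Fin s → ESp d) → ℝ)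
    (hFNint : ∀ N s, Integrable (FN N s)) (hFNsym : ∀ N s, SymFun (FN N s))
    (hFint : ∀ s, Integrable (F s)) (hFsym : ∀ s, SymFun (F s))
    (hpw : ∀ s : ℕ, ∀ φ : (Fin s → ESp d) → ℝ, BddMeas φ →
      Tendsto (fun N => ∫ V, FN N s V * φ V) atTop (nhds (∫ V, F s V * φ V))) :
    ∀ s : ℕ, ∀ φ : (Fin s → ESp d) → ℝ, BddMeas φ →
      Tendsto
        (fun N => ∫ V, (∑ k ∈ Finset.range M, bbgkyC b T M β N s k (FN N (s + k)) V) * φ V)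
        atTop
        (nhds (∫ V, (∑ k ∈ Finset.range M, boltzC b T β s k (F (s + k)) V) * φ V)) := by
  intro s φ hφ
  have hN : ∀ N, ∫ V, (∑ k ∈ Finset.range M, bbgkyC b T M β N s k (FN N (s + k)) V) * φ V =
      ∑ k ∈ Finset.range M, ∫ V, bbgkyC b T M β N s k (FN N (s + k)) V * φ V := fun N => by
    simp only [Finset.sum_mul]
    exact integral_finsetSum _ fun k hk => hφ.integrable_mul
      (integrable_bbgkyC hmeas h1 (Finset.mem_range.1 hk) N (hFNint N (s + k)))
  have hlim : ∫ V, (∑ k ∈ Finset.range M, boltzC b T β s k (F (s + k)) V) * φ V =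
      ∑ k ∈ Finset.range M, ∫ V, boltzC b T β s k (F (s + k)) V * φ V := by
    simp only [Finset.sum_mul]
    exact integral_finsetSum _ fun k hk => hφ.integrable_mul
      (integrable_boltzC hmeas h1 (Finset.mem_range.1 hk) (hFint (s + k)))
  simp only [hN, hlim]
  exact tendsto_finsetSum _ fun k hk =>
    tendsto_integral_bbgkyC_mul hmeas h1 (Finset.mem_range.1 hk) (fun N => hFNint N (s + k))
      (hFint (s + k)) (hpw (s + k)) hφ
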